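/- Let n ≥ 1 and κ > 0. If π ∈ A^B_κ(rect(n,n)) satisfies (Row^B_A)^n(π) = Flip(π), then the Stanley–Thomas word of π is constant: ST(π)_i = √κ for all 1 ≤ i ≤ 2n. In particular, for every π ∈ F^B_κ(A^n), the Stanley–Thomas word of ∇(ι^B_A π) ∈ A^B_{4κ²}(rect(n+1,n+1)) is constantly equal to 2κ. -/

import Mathlib

open scoped Classical

noncomputable section

/-- `P̂`: the poset `P` with a new minimum `0̂` and a new maximum `1̂` adjoined. -/
abbrev Phat (P : Type) := WithBot (WithTop P)

instance {P : Type} [Fintype P] : Fintype (Phat P) :=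
  inferInstanceAs (Fintype (Option (Option P)))

/-- The inclusion of `P` into `P̂`. -/
def emb {P : Type} (p : P) : Phat P := ((p : WithTop P) : WithBot (WithTop P))

/-- The new maximum `1̂` of `P̂`. -/
def topHat (P : Type) : Phat P := ((⊤ : WithTop P) : WithBot (WithTop P))

variable {P : Type} [Fintype P] [PartialOrder P]

/-- `∑_{y ⋖ x} π(y)`. -/
def covSumBelow (π : Phat P → ℝ) (x : Phat P) : ℝ :=
  ∑ y : Phat P, if y ⋖ x then π y else 0

/-- `∑_{x ⋖ y} 1/π(y)`. -/
def covSumAboveInv (π : Phat P → ℝ) (x : Phat P) : ℝ :=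
  ∑ y : Phat P, if x ⋖ y then (π y)⁻¹ else 0

/-- The birational order-filter rank toggle `𝐭_i`, in simultaneous form (it agrees with the
composition of the pairwise commuting birational order filter toggles `t_p` over `p ∈ P_i`,
since a toggle `t_p` only changes the value at `p` and only reads values at `p` and at
elements covering or covered by `p`, which have different ranks). -/
def rankToggleB (rk : P → ℕ) (i : ℕ) (π : Phat P → ℝ) : Phat P → ℝ :=
  fun x =>
    if ∃ p : P, rk p = i ∧ x = emb p then
      covSumBelow π x / (π x * covSumAboveInv π x)
    else π x

/-- Apply a word of rank toggles; the head of the list is applied last, matching the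
convention that in a product `𝐭_{i_1} 𝐭_{i_2} ⋯ 𝐭_{i_k}` the rightmost factor acts first. -/
def applyB (rk : P → ℕ) : List ℕ → (Phat P → ℝ) → Phat P → ℝ
  | [] => fun π => π
  | i :: w => fun π => rankToggleB rk i (applyB rk w π)

/-- The word `𝐭_0 𝐭_1 ⋯ 𝐭_r` for rowmotion. -/
def rowWordB (r : ℕ) : List ℕ := List.range (r + 1)

/-- The word `(𝐭_r)(𝐭_{r-1} 𝐭_r) ⋯ (𝐭_0 𝐭_1 ⋯ 𝐭_r)` for rowvacuation. -/
def rvacWordB (r : ℕ) : List ℕ :=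
  (List.range (r + 1)).foldr (fun k acc => (List.range (r + 1)).drop (r - k) ++ acc) []

/-- The word `(𝐭_0)(𝐭_1 𝐭_0) ⋯ (𝐭_r 𝐭_{r-1} ⋯ 𝐭_0)` for dual rowvacuation. -/
def drvacWordB (r : ℕ) : List ℕ :=
  (List.range (r + 1)).foldr (fun k acc => (List.range (k + 1)).reverse ++ acc) []

/-- Birational order filter rowmotion `Row^B_F = 𝐭_0 𝐭_1 ⋯ 𝐭_r`. -/
def RowB (rk : P → ℕ) (r : ℕ) : (Phat P → ℝ) → Phat P → ℝ := applyB rk (rowWordB r)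

/-- The inverse of birational order filter rowmotion, `(Row^B_F)⁻¹ = 𝐭_r ⋯ 𝐭_1 𝐭_0`
(each toggle is an involution, so the reversed word gives the inverse map). -/
def RowInvB (rk : P → ℕ) (r : ℕ) : (Phat P → ℝ) → Phat P → ℝ := applyB rk (rowWordB r).reverse

/-- Birational order filter rowvacuation `Rvac^B_F`. -/
def RvacB (rk : P → ℕ) (r : ℕ) : (Phat P → ℝ) → Phat P → ℝ := applyB rk (rvacWordB r)

/-- Birational order filter dual rowvacuation `DRvac^B_F`. -/
def DRvacB (rk : P → ℕ) (r : ℕ) : (Phat P → ℝ) → Phat P → ℝ := applyB rk (drvacWordB r)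

end

noncomputable section

variable {P : Type} [Fintype P] [PartialOrder P]

/-- The sum, over all maximal chains `C` of `P` containing `p`, of `∏_{y ∈ C} π(y)`. -/
def chainSum (π : P → ℝ) (p : P) : ℝ :=
  ∑ C ∈ Finset.univ.filter
      (fun C : Finset P => IsMaxChain (· ≤ ·) (C : Set P) ∧ p ∈ C),
    ∏ y ∈ C, π y

/-- The birational antichain rank toggle `𝛕_i`, in simultaneous form (it agrees with the
composition of the pairwise commuting birational antichain toggles `τ_p` over `p ∈ P_i`,
since in a graded poset no maximal chain contains two distinct elements of the same rank). -/
def arankToggleB (κ : ℝ) (rk : P → ℕ) (i : ℕ) (π : P → ℝ) : P → ℝ :=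
  fun x => if rk x = i then κ / chainSum π x else π x

/-- Apply a word of antichain rank toggles; the head of the list is applied last. -/
def aApplyB (κ : ℝ) (rk : P → ℕ) : List ℕ → (P → ℝ) → P → ℝ
  | [] => fun π => π
  | i :: w => fun π => arankToggleB κ rk i (aApplyB κ rk w π)

/-- The word `𝛕_r 𝛕_{r-1} ⋯ 𝛕_0` for antichain rowmotion. -/
def arowWordB (r : ℕ) : List ℕ := (List.range (r + 1)).reverse

/-- The word `(𝛕_r)(𝛕_r 𝛕_{r-1}) ⋯ (𝛕_r 𝛕_{r-1} ⋯ 𝛕_1 𝛕_0)` for antichain rowvacuation. -/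
def arvacWordB (r : ℕ) : List ℕ :=
  (List.range (r + 1)).foldr
    (fun k acc => (List.range (r + 1)).reverse.take (k + 1) ++ acc) []

/-- Birational antichain rowmotion `Row^B_A = 𝛕_r 𝛕_{r-1} ⋯ 𝛕_0`. -/
def RowAB (κ : ℝ) (rk : P → ℕ) (r : ℕ) : (P → ℝ) → P → ℝ := aApplyB κ rk (arowWordB r)

/-- Birational antichain rowvacuation `Rvac^B_A`. -/
def RvacAB (κ : ℝ) (rk : P → ℕ) (r : ℕ) : (P → ℝ) → P → ℝ := aApplyB κ rk (arvacWordB r)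

end

noncomputable section

/-- The down-transfer `∇ : F^B_κ(P) → A^B_κ(P)`, `(∇π)(x) = π(x) / ∑_{y ⋖ x} π(y)`. -/
def downT {P : Type} [Fintype P] [PartialOrder P] (π : Phat P → ℝ) : P → ℝ :=
  fun x => π (emb x) / covSumBelow π (emb x)

end

/-- The underlying set of the poset `Aⁿ`: pairs `(i,j)` with `1 ≤ i ≤ j ≤ n`,
representing the intervals `[i,j] ⊆ [n]`. -/
def AnP (n : ℕ) : Type := {p : ℕ × ℕ // 1 ≤ p.1 ∧ p.1 ≤ p.2 ∧ p.2 ≤ n}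

/-- `Aⁿ` is ordered by containment of intervals. -/
instance (n : ℕ) : PartialOrder (AnP n) where
  le x y := y.val.1 ≤ x.val.1 ∧ x.val.2 ≤ y.val.2
  le_refl x := ⟨le_refl _, le_refl _⟩
  le_trans x y z h1 h2 := ⟨le_trans h2.1 h1.1, le_trans h1.2 h2.2⟩
  le_antisymm x y h1 h2 :=
    Subtype.ext (Prod.ext_iff.mpr ⟨le_antisymm h2.1 h1.1, le_antisymm h1.2 h2.2⟩)

instance (n : ℕ) : Fintype (AnP n) :=
  Fintype.subtype
    ((Finset.Icc 1 n ×ˢ Finset.Icc 1 n).filter (fun p => 1 ≤ p.1 ∧ p.1 ≤ p.2 ∧ p.2 ≤ n))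
    (by
      intro x
      simp only [Finset.mem_filter, Finset.mem_product, Finset.mem_Icc]
      omega)

/-- The rank function of `Aⁿ`: `rk [i,j] = j - i`; `Aⁿ` is graded of rank `n - 1`. -/
def rkAn (n : ℕ) : AnP n → ℕ := fun p => p.val.2 - p.val.1
noncomputable section

/-- The underlying set of the rectangle poset `rect(a,b)`:
pairs `(i,j)` with `1 ≤ i ≤ a`, `1 ≤ j ≤ b`. -/
def RectP (a b : ℕ) : Type := {p : ℕ × ℕ // 1 ≤ p.1 ∧ p.1 ≤ a ∧ 1 ≤ p.2 ∧ p.2 ≤ b}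

/-- `rect(a,b)` carries the componentwise order. -/
instance (a b : ℕ) : PartialOrder (RectP a b) where
  le x y := x.val.1 ≤ y.val.1 ∧ x.val.2 ≤ y.val.2
  le_refl x := ⟨le_refl _, le_refl _⟩
  le_trans x y z h1 h2 := ⟨le_trans h1.1 h2.1, le_trans h1.2 h2.2⟩
  le_antisymm x y h1 h2 :=
    Subtype.ext (Prod.ext_iff.mpr ⟨le_antisymm h1.1 h2.1, le_antisymm h1.2 h2.2⟩)

instance (a b : ℕ) : Fintype (RectP a b) :=
  Fintype.subtype
    ((Finset.Icc 1 a ×ˢ Finset.Icc 1 b).filter (fun p => 1 ≤ p.1 ∧ p.1 ≤ a ∧ 1 ≤ p.2 ∧ p.2 ≤ b))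
    (by
      intro x
      simp only [Finset.mem_filter, Finset.mem_product, Finset.mem_Icc]
      omega)

/-- The rank function of `rect(a,b)`: `rk (i,j) = i + j - 2`;
`rect(a,b)` is graded of rank `a + b - 2`. -/
def rkRect (a b : ℕ) : RectP a b → ℕ := fun p => p.val.1 + p.val.2 - 2

/-- The poset automorphism `Flip` of `Aⁿ`, `[i,j] ↦ [n+1-j, n+1-i]`
(the reflection of `Aⁿ` across its vertical axis of symmetry). -/
def flipAn (n : ℕ) (p : AnP n) : AnP n :=
  ⟨(n + 1 - p.val.2, n + 1 - p.val.1), by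
    have h := p.2
    show 1 ≤ n + 1 - p.val.2 ∧ n + 1 - p.val.2 ≤ n + 1 - p.val.1 ∧ n + 1 - p.val.1 ≤ n
    omega⟩

/-- `Flip` acting on labelings of `Âⁿ`: `(Flip π)(p) = π(Flip p)`, fixing `0̂` and `1̂`. -/
def flipLabelAn (n : ℕ) (π : Phat (AnP n) → ℝ) : Phat (AnP n) → ℝ :=
  fun x => if h : ∃ q : AnP n, x = emb q then π (emb (flipAn n h.choose)) else π x

/-- The poset automorphism `Flip` of the square `rect(m,m)`: `(i,j) ↦ (j,i)`. -/
def flipRect (m : ℕ) (p : RectP m m) : RectP m m :=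
  ⟨(p.val.2, p.val.1), ⟨p.2.2.2.1, p.2.2.2.2, p.2.1, p.2.2.1⟩⟩

/-- `Flip` acting on labelings of the square with `0̂`, `1̂` adjoined:
`(Flip π)(p) = π(Flip p)`, fixing `0̂` and `1̂`. -/
def flipLabelRect (m : ℕ) (π : Phat (RectP m m) → ℝ) : Phat (RectP m m) → ℝ :=
  fun x => if h : ∃ q : RectP m m, x = emb q then π (emb (flipRect m h.choose)) else π x

/-- The value of the Grinberg–Roby embedding `ι^B_A` at an element `(i,j)` of
`rect(n+1,n+1)`: ranks `n+1,…,2n` (i.e. `i+j > n+2`) are filled with `4κ·π`, the middle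
rank (`i+j = n+2`) with `2κ`, and ranks `0,…,n-1` (i.e. `i+j < n+2`) with
`κ/(Rvac^B_F π)`, suitably re-indexed. -/
def iotaVal (n : ℕ) (κ : ℝ) (π : Phat (AnP n) → ℝ) (q : RectP (n + 1) (n + 1)) : ℝ :=
  if h : n + 2 < q.val.1 + q.val.2 then
    4 * κ * π (emb (⟨(n + 2 - q.val.1, q.val.2 - 1), by
      have hq := q.2
      show 1 ≤ n + 2 - q.val.1 ∧ n + 2 - q.val.1 ≤ q.val.2 - 1 ∧ q.val.2 - 1 ≤ n
      omega⟩ : AnP n))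
  else if h2 : q.val.1 + q.val.2 = n + 2 then 2 * κ
  else
    κ / RvacB (rkAn n) (n - 1) π (emb (⟨(q.val.2, n + 1 - q.val.1), by
      have hq := q.2
      show 1 ≤ q.val.2 ∧ q.val.2 ≤ n + 1 - q.val.1 ∧ n + 1 - q.val.1 ≤ n
      omega⟩ : AnP n))

/-- The Grinberg–Roby embedding `ι^B_A : F^B_κ(Aⁿ) → F^B_{4κ²}(rect(n+1,n+1))`. -/
def iotaAn (n : ℕ) (κ : ℝ) (π : Phat (AnP n) → ℝ) : Phat (RectP (n + 1) (n + 1)) → ℝ :=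
  fun x =>
    if x = (⊥ : Phat (RectP (n + 1) (n + 1))) then 1
    else if x = topHat (RectP (n + 1) (n + 1)) then 4 * κ ^ 2
    else if h : ∃ q : RectP (n + 1) (n + 1), x = emb q then iotaVal n κ π h.choose
    else 0

/-- The Stanley–Thomas word of `π ∈ A^B_κ(rect(a,b))`:
`ST(π)_i = ∏_{j=1}^b π(i,j)` for `1 ≤ i ≤ a`, and
`ST(π)_i = κ / ∏_{j=1}^a π(j, i-a)` for `a+1 ≤ i ≤ a+b`. -/
def STword (a b : ℕ) (κ : ℝ) (π : RectP a b → ℝ) (i : ℕ) : ℝ :=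
  if i ≤ a then
    ∏ j ∈ Finset.Icc 1 b,
      (if h : 1 ≤ i ∧ i ≤ a ∧ 1 ≤ j ∧ j ≤ b then π ⟨(i, j), h⟩ else 1)
  else
    κ / ∏ j ∈ Finset.Icc 1 a,
      (if h : 1 ≤ j ∧ j ≤ a ∧ 1 ≤ i - a ∧ i - a ≤ b then π ⟨(j, i - a), h⟩ else 1)

end

section Chains

variable {P : Type} [PartialOrder P]

/-- `C` is a maximal chain of the subposet `S`. -/
def IsMaxChainIn (S : Set P) (C : Finset P) : Prop :=
  (∀ a ∈ C, a ∈ S) ∧ (∀ a ∈ C, ∀ b ∈ C, a ≤ b ∨ b ≤ a) ∧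
    ∀ x ∈ S, (∀ c ∈ C, x ≤ c ∨ c ≤ x) → x ∈ C

lemma isMaxChain_iff_isMaxChainIn (C : Finset P) :
    IsMaxChain (· ≤ ·) (C : Set P) ↔ IsMaxChainIn Set.univ C := by
  constructor
  · rintro ⟨hc, hm⟩
    refine ⟨fun _ _ => trivial, fun a ha b hb => hc.total ha hb, fun x _ hx => ?_⟩
    have h := hm (t := insert x (C : Set P)) (hc.insert fun c hc _ => hx c hc)
      (Set.subset_insert _ _)
    have : x ∈ (C : Set P) := h ▸ Set.mem_insert _ _
    exact this
  · rintro ⟨-, hc, hm⟩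
    refine ⟨fun a ha b hb _ => hc a ha b hb, fun t ht hCt => hCt.antisymm fun x hx => ?_⟩
    exact hm x trivial fun c hc => ht.total hx (hCt hc)

variable [Fintype P]

/-- The sum of the weights of the maximal chains of the subposet `S`. -/
noncomputable def chainSumIn (w : P → ℝ) (S : Set P) : ℝ :=
  ∑ C ∈ Finset.univ.filter (fun C : Finset P => IsMaxChainIn S C), ∏ y ∈ C, w y

lemma chainSumIn_congr {w w' : P → ℝ} {S : Set P} (h : ∀ x ∈ S, w x = w' x) :
    chainSumIn w S = chainSumIn w' S := by
  refine Finset.sum_congr rfl fun C hC => Finset.prod_congr rfl fun y hy => h y ?_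
  exact (Finset.mem_filter.1 hC).2.1 y hy

lemma chainSum_eq (w : P → ℝ) (p : P) :
    chainSum w p = chainSumIn w (Set.Iio p) * w p * chainSumIn w (Set.Ioi p) := by
  unfold chainSum chainSumIn
  rw [mul_right_comm, Finset.sum_mul_sum, ← Finset.sum_product', Finset.sum_mul]
  refine Finset.sum_bij' (fun C _ => (C.filter (· < p), C.filter (p < ·)))
    (fun A _ => insert p (A.1 ∪ A.2)) ?_ ?_ ?_ ?_ ?_
  · intro C hC
    simp only [Finset.mem_filter, Finset.mem_univ, true_and, isMaxChain_iff_isMaxChainIn,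
      Finset.mem_product] at hC ⊢
    obtain ⟨⟨-, h2, h3⟩, hp⟩ := hC
    refine ⟨⟨fun a ha => (Finset.mem_filter.1 ha).2, fun a ha b hb => h2 a
      (Finset.mem_filter.1 ha).1 b (Finset.mem_filter.1 hb).1, fun x hx hc => ?_⟩,
      ⟨fun a ha => (Finset.mem_filter.1 ha).2, fun a ha b hb => h2 a
      (Finset.mem_filter.1 ha).1 b (Finset.mem_filter.1 hb).1, fun x hx hc => ?_⟩⟩
    · refine Finset.mem_filter.2 ⟨h3 x trivial fun c hcC => ?_, hx⟩
      by_cases hcp : c < p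
      · exact hc c (Finset.mem_filter.2 ⟨hcC, hcp⟩)
      · left
        rcases h2 c hcC p hp with h | h
        · exact (h.eq_or_lt.resolve_right hcp) ▸ le_of_lt hx
        · exact (le_of_lt hx).trans h
    · refine Finset.mem_filter.2 ⟨h3 x trivial fun c hcC => ?_, hx⟩
      by_cases hcp : p < c
      · exact hc c (Finset.mem_filter.2 ⟨hcC, hcp⟩)
      · right
        rcases h2 p hp c hcC with h | h
        · exact (h.eq_or_lt.resolve_right hcp) ▸ le_of_lt hx
        · exact h.trans (le_of_lt hx)
  · rintro ⟨A, B⟩ h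
    simp only [Finset.mem_filter, Finset.mem_univ, true_and, isMaxChain_iff_isMaxChainIn,
      Finset.mem_product] at h ⊢
    obtain ⟨⟨a1, a2, a3⟩, b1, b2, b3⟩ := h
    have a1' : ∀ a ∈ A, a < p := a1
    have b1' : ∀ b ∈ B, p < b := b1
    refine ⟨⟨fun _ _ => trivial, ?_, fun x _ hx => ?_⟩, Finset.mem_insert_self _ _⟩
    · simp only [Finset.mem_insert, Finset.mem_union]
      rintro a (rfl | ha | ha) b (rfl | hb | hb)
      · exact Or.inl le_rfl
      · exact Or.inr (a1' b hb).le
      · exact Or.inl (b1' b hb).le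
      · exact Or.inl (a1' a ha).le
      · exact a2 a ha b hb
      · exact Or.inl ((a1' a ha).trans (b1' b hb)).le
      · exact Or.inr (b1' a ha).le
      · exact Or.inr ((a1' b hb).trans (b1' a ha)).le
      · exact b2 a ha b hb
    · simp only [Finset.mem_insert, Finset.mem_union] at hx ⊢
      rcases hx p (Or.inl rfl) with h | h
      · rcases h.eq_or_lt with h | h
        · exact Or.inl h
        · exact Or.inr (Or.inl (a3 x h fun c hc => hx c (Or.inr (Or.inl hc))))
      · rcases h.eq_or_lt with h | h
        · exact Or.inl h.symm
        · exact Or.inr (Or.inr (b3 x h fun c hc => hx c (Or.inr (Or.inr hc))))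
  · intro C hC
    simp only [Finset.mem_filter, Finset.mem_univ, true_and, isMaxChain_iff_isMaxChainIn] at hC
    obtain ⟨⟨-, h2, -⟩, hp⟩ := hC
    ext a
    simp only [Finset.mem_insert, Finset.mem_union, Finset.mem_filter]
    constructor
    · rintro (rfl | h | h)
      exacts [hp, h.1, h.1]
    · intro ha
      rcases h2 a ha p hp with h | h <;> rcases h.eq_or_lt with h | h
      exacts [Or.inl h, Or.inr (Or.inl ⟨ha, h⟩), Or.inl h.symm, Or.inr (Or.inr ⟨ha, h⟩)]
  · rintro ⟨A, B⟩ h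
    simp only [Finset.mem_filter, Finset.mem_univ, true_and, Finset.mem_product] at h
    have a1 : ∀ a ∈ A, a < p := h.1.1
    have b1 : ∀ b ∈ B, p < b := h.2.1
    ext a
    · simp only [Finset.mem_filter, Finset.mem_insert, Finset.mem_union]
      constructor
      · rintro ⟨rfl | ha | ha, hlt⟩
        exacts [(lt_irrefl _ hlt).elim, ha, (lt_asymm hlt (b1 a ha)).elim]
      · exact fun ha => ⟨Or.inr (Or.inl ha), a1 a ha⟩
    · simp only [Finset.mem_filter, Finset.mem_insert, Finset.mem_union]
      constructor
      · rintro ⟨rfl | ha | ha, hlt⟩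
        exacts [(lt_irrefl _ hlt).elim, (lt_asymm hlt (a1 a ha)).elim, ha]
      · exact fun ha => ⟨Or.inr (Or.inr ha), b1 a ha⟩
  · intro C hC
    simp only [Finset.mem_filter, Finset.mem_univ, true_and, isMaxChain_iff_isMaxChainIn] at hC
    obtain ⟨⟨-, h2, -⟩, hp⟩ := hC
    have hC : C = insert p (C.filter (· < p) ∪ C.filter (p < ·)) := by
      ext a
      simp only [Finset.mem_insert, Finset.mem_union, Finset.mem_filter]
      constructor
      · intro ha
        rcases h2 a ha p hp with h | h <;> rcases h.eq_or_lt with h | h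
        exacts [Or.inl h, Or.inr (Or.inl ⟨ha, h⟩), Or.inl h.symm, Or.inr (Or.inr ⟨ha, h⟩)]
      · rintro (rfl | h | h)
        exacts [hp, h.1, h.1]
    conv_lhs => rw [hC]
    rw [Finset.prod_insert (by simp), Finset.prod_union, mul_comm]
    exact Finset.disjoint_left.2 fun a ha hb =>
      lt_asymm (Finset.mem_filter.1 ha).2 (Finset.mem_filter.1 hb).2

lemma chainSumIn_Iio (w : P → ℝ) (x : P) :
    chainSumIn w (Set.Iio x) =
      if IsMin x then 1 else ∑ y, if y ⋖ x then w y * chainSumIn w (Set.Iio y) else 0 := by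
  split_ifs with hx
  · have h0 : ∀ a, ¬ a < x := fun a ha => hx.not_lt ha
    have : (Finset.univ.filter fun C : Finset P => IsMaxChainIn (Set.Iio x) C) = {∅} := by
      ext C
      simp only [Finset.mem_filter, Finset.mem_univ, true_and, Finset.mem_singleton]
      constructor
      · intro h
        exact Finset.eq_empty_of_forall_notMem fun a ha => h0 a (h.1 a ha)
      · rintro rfl
        exact ⟨by simp, by simp, fun y hy => (h0 y hy).elim⟩
    simp [chainSumIn, this]
  · rw [← Finset.sum_filter]
    simp only [chainSumIn, Finset.mul_sum]
    rw [Finset.sum_sigma']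
    symm
    refine Finset.sum_bij (fun a _ => insert a.1 a.2) ?_ ?_ ?_ ?_
    · rintro ⟨y, A⟩ h
      simp only [Finset.mem_sigma, Finset.mem_filter, Finset.mem_univ, true_and] at h ⊢
      obtain ⟨hy, h1, h2, h3⟩ := h
      refine ⟨?_, ?_, ?_⟩
      · intro a ha
        rcases Finset.mem_insert.1 ha with rfl | ha
        · exact hy.lt
        · exact lt_trans (h1 a ha) hy.lt
      · intro a ha b hb
        rcases Finset.mem_insert.1 ha with ha' | ha' <;>
          rcases Finset.mem_insert.1 hb with hb' | hb'
        · exact Or.inl (ha'.trans hb'.symm).le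
        · exact Or.inr (ha' ▸ (h1 b hb').le)
        · exact Or.inl (hb' ▸ (h1 a ha').le)
        · exact h2 a ha' b hb'
      · intro z hz hc
        rcases hc y (Finset.mem_insert_self _ _) with h | h
        · rcases h.eq_or_lt with rfl | h
          · exact Finset.mem_insert_self _ _
          · exact Finset.mem_insert_of_mem
              (h3 z h fun c hcA => hc c (Finset.mem_insert_of_mem hcA))
        · rcases h.eq_or_lt with rfl | h
          · exact Finset.mem_insert_self _ _
          · exact (hy.2 h hz).elim
    · rintro ⟨y, A⟩ h ⟨y', A'⟩ h' heq
      simp only [Finset.mem_sigma, Finset.mem_filter, Finset.mem_univ, true_and] at h h' heq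
      have hyA : y ∉ A := fun hy => lt_irrefl y (h.2.1 y hy)
      have hyA' : y' ∉ A' := fun hy => lt_irrefl y' (h'.2.1 y' hy)
      have e1 : y ≤ y' := by
        rcases Finset.mem_insert.1 (heq ▸ Finset.mem_insert_self y A) with e | e
        · exact e.le
        · exact (h'.2.1 y e).le
      have e2 : y' ≤ y := by
        rcases Finset.mem_insert.1 (heq.symm ▸ Finset.mem_insert_self y' A') with e | e
        · exact e.le
        · exact (h.2.1 y' e).le
      obtain rfl := le_antisymm e1 e2
      have : A = A' := by
        rw [← Finset.erase_insert hyA, heq, Finset.erase_insert hyA']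
      rw [this]
    · intro C hC
      simp only [Finset.mem_filter, Finset.mem_univ, true_and] at hC
      obtain ⟨h1, h2, h3⟩ := hC
      have hne : C.Nonempty := by
        by_contra hC
        rw [Finset.not_nonempty_iff_eq_empty] at hC
        subst hC
        obtain ⟨a, ha⟩ := not_isMin_iff.1 hx
        simpa using h3 a ha (by simp)
      obtain ⟨y, hyC, hymax⟩ := Finset.exists_maximal hne
      have hle : ∀ a ∈ C, a ≤ y := fun a ha => by
        rcases h2 a ha y hyC with h | h
        · exact h
        · exact hymax ha h
      refine ⟨⟨y, C.erase y⟩, ?_, Finset.insert_erase hyC⟩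
      simp only [Finset.mem_sigma, Finset.mem_filter, Finset.mem_univ, true_and]
      refine ⟨⟨h1 y hyC, fun z hyz hzx => ?_⟩, ?_, ?_, ?_⟩
      · exact hyz.not_ge (hle z (h3 z hzx fun c hc => Or.inr ((hle c hc).trans hyz.le)))
      · intro a ha
        rw [Finset.mem_erase] at ha
        exact lt_of_le_of_ne (hle a ha.2) ha.1
      · intro a ha b hb
        exact h2 a (Finset.mem_of_mem_erase ha) b (Finset.mem_of_mem_erase hb)
      · intro z hz hc
        refine Finset.mem_erase.2 ⟨(ne_of_lt hz), h3 z (lt_trans hz (h1 y hyC)) fun c hcC => ?_⟩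
        by_cases hcy : c = y
        · exact Or.inl (hcy ▸ le_of_lt hz)
        · exact hc c (Finset.mem_erase.2 ⟨hcy, hcC⟩)
    · rintro ⟨y, A⟩ h
      simp only [Finset.mem_sigma, Finset.mem_filter, Finset.mem_univ, true_and] at h
      rw [Finset.prod_insert fun hy => lt_irrefl y (h.2.1 y hy)]

lemma chainSumIn_dual (w : P → ℝ) (x : P) :
    chainSumIn w (Set.Ioi x) =
      chainSumIn (P := Pᵒᵈ) (fun y => w (OrderDual.ofDual y)) (Set.Iio (OrderDual.toDual x)) := by
  refine Finset.sum_congr ?_ fun _ _ => rfl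
  have key : ∀ C : Finset P, IsMaxChainIn (Set.Ioi x) C ↔
      IsMaxChainIn (P := Pᵒᵈ) (Set.Iio (OrderDual.toDual x)) C := fun C =>
    and_congr Iff.rfl (and_congr
      ⟨fun h a ha b hb => h b hb a ha, fun h a ha b hb => h b hb a ha⟩
      (forall₂_congr fun z _ => imp_congr (forall₂_congr fun c _ => or_comm) Iff.rfl))
  exact Finset.ext fun C => (Finset.mem_filter_univ C).trans
    ((key C).trans (Finset.mem_filter_univ (α := Finset Pᵒᵈ) C).symm)

lemma chainSumIn_Ioi (w : P → ℝ) (x : P) :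
    chainSumIn w (Set.Ioi x) =
      if IsMax x then 1 else ∑ y, if x ⋖ y then w y * chainSumIn w (Set.Ioi y) else 0 := by
  rw [chainSumIn_dual, chainSumIn_Iio, ← Equiv.sum_comp OrderDual.toDual]
  refine if_congr isMin_toDual_iff rfl (Finset.sum_congr rfl fun y _ => ?_)
  refine if_congr toDual_covBy_toDual_iff ?_ rfl
  rw [chainSumIn_dual, OrderDual.ofDual_toDual]

/-- `∑_{y ⋖ x} f(y)`, with the value `1` at the new minimum. -/
noncomputable def sumBelow (f : P → ℝ) (x : P) : ℝ :=
  if IsMin x then 1 else ∑ y, if y ⋖ x then f y else 0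

/-- `∑_{x ⋖ y} 1/f(y)`, with the value `κ` at the new maximum. -/
noncomputable def sumAboveInv (κ : ℝ) (f : P → ℝ) (x : P) : ℝ :=
  if IsMax x then κ⁻¹ else ∑ y, if x ⋖ y then (f y)⁻¹ else 0

lemma sumBelow_pos {f : P → ℝ} {x : P} (hf : ∀ y < x, 0 < f y) : 0 < sumBelow f x := by
  unfold sumBelow
  split_ifs with hx
  · exact one_pos
  · obtain ⟨a, ha⟩ := not_isMin_iff.1 hx
    obtain ⟨b, -, hb⟩ := exists_le_covBy_of_lt ha
    refine Finset.sum_pos' (fun y _ => ?_) ⟨b, Finset.mem_univ _, ?_⟩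
    · split_ifs with h
      · exact (hf y h.lt).le
      · exact le_rfl
    · rw [if_pos hb]
      exact hf b hb.lt

lemma sumAboveInv_pos {κ : ℝ} (hκ : 0 < κ) {f : P → ℝ} {x : P} (hf : ∀ y, x < y → 0 < f y) :
    0 < sumAboveInv κ f x := by
  unfold sumAboveInv
  split_ifs with hx
  · exact inv_pos.2 hκ
  · obtain ⟨a, ha⟩ := not_isMax_iff.1 hx
    obtain ⟨b, hb, -⟩ := exists_covBy_le_of_lt ha
    refine Finset.sum_pos' (fun y _ => ?_) ⟨b, Finset.mem_univ _, ?_⟩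
    · split_ifs with h
      · exact (inv_pos.2 (hf y h.lt)).le
      · exact le_rfl
    · rw [if_pos hb]
      exact inv_pos.2 (hf b hb.lt)

lemma chainSumIn_Iio_eq (w : P → ℝ) (x : P) :
    chainSumIn w (Set.Iio x) = sumBelow (fun y => w y * chainSumIn w (Set.Iio y)) x :=
  chainSumIn_Iio w x

lemma chainSumIn_Ioi_pos {w : P → ℝ} (hw : ∀ x, 0 < w x) (x : P) :
    0 < chainSumIn w (Set.Ioi x) := by
  have key : ∀ (Q : Type) [Fintype Q] [PartialOrder Q] (v : Q → ℝ), (∀ x, 0 < v x) →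
      ∀ x, 0 < chainSumIn v (Set.Iio x) := by
    intro Q _ _ v hv x
    induction x using WellFoundedLT.induction with
    | ind x ih =>
      rw [chainSumIn_Iio_eq]
      exact sumBelow_pos fun y hy => mul_pos (hv y) (ih y hy)
  rw [chainSumIn_dual]
  exact key _ _ (fun y => hw _) _

/-- Antichain rowmotion transports the up-transfer of a filter labeling to its down-transfer. -/
theorem exists_transfer_RowAB {κ : ℝ} (hκ : 0 < κ) {rk : P → ℕ} (hrk : StrictMono rk) {r : ℕ}
    (hr : ∀ x, rk x ≤ r) {w : P → ℝ} (hw : ∀ x, 0 < w x) :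
    ∃ f : P → ℝ, (∀ x, 0 < f x) ∧ (∀ x, w x = 1 / (f x * sumAboveInv κ f x)) ∧
      ∀ x, RowAB κ rk r w x = f x / sumBelow f x := by
  have hU := chainSumIn_Ioi_pos hw
  set f : P → ℝ := fun x => κ / (w x * chainSumIn w (Set.Ioi x)) with hf
  have hfpos : ∀ x, 0 < f x := fun x => div_pos hκ (mul_pos (hw x) (hU x))
  have hUA : ∀ x, chainSumIn w (Set.Ioi x) = κ * sumAboveInv κ f x := by
    intro x
    rw [chainSumIn_Ioi, sumAboveInv]
    split_ifs with hx
    · rw [mul_inv_cancel₀ hκ.ne']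
    · rw [Finset.mul_sum]
      refine Finset.sum_congr rfl fun y _ => ?_
      split_ifs
      · rw [hf]
        field_simp
      · simp
  have hB : ∀ x, 0 < sumBelow f x := fun x => sumBelow_pos fun y _ => hfpos y
  set w' : P → ℝ := fun x => f x / sumBelow f x with hw'
  have hD : ∀ x, chainSumIn w' (Set.Iio x) = sumBelow f x := by
    intro x
    induction x using WellFoundedLT.induction with
    | ind x ih =>
      rw [chainSumIn_Iio_eq]
      refine if_congr Iff.rfl rfl (Finset.sum_congr rfl fun y _ => ?_)
      split_ifs with h
      · change w' y * chainSumIn w' (Set.Iio y) = f y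
        rw [ih y h.lt]
        exact div_mul_cancel₀ _ (hB y).ne'
      · rfl
  refine ⟨f, hfpos, fun x => ?_, ?_⟩
  · have h1 := hUA x
    have h2 := hU x
    have h3 : sumAboveInv κ f x = chainSumIn w (Set.Ioi x) / κ := by
      rw [h1]; field_simp
    rw [h3, hf]
    have := hw x
    field_simp
  · have key : ∀ k, aApplyB κ rk (List.range k).reverse w =
        fun x => if rk x < k then w' x else w x := by
      intro k
      induction k with
      | zero => ext x; simp [aApplyB]
      | succ k ih =>
        rw [List.range_succ, List.reverse_append, List.reverse_singleton, List.singleton_append]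
        ext x
        simp only [aApplyB, ih, arankToggleB]
        split_ifs with h1 h2 h2 h3 h3
        · rw [chainSum_eq, if_neg (by omega),
            chainSumIn_congr (w' := w') (S := Set.Iio x) fun y hy => if_pos (by
              have := hrk (show y < x from hy); omega),
            chainSumIn_congr (w' := w) (S := Set.Ioi x) fun y hy => if_neg (by
              have := hrk (show x < y from hy); omega), hD]
          have := hU x
          have := hw x
          have := hB x
          rw [hw', hf]
          field_simp
        all_goals first | rfl | omega
    intro x
    rw [RowAB, arowWordB, key]
    exact if_pos (Nat.lt_succ_of_le (hr x))

end Chains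

section Rectangle

lemma sum_ite_val_eq {p : ℕ × ℕ → Prop} [Fintype {x // p x}] (g : {x // p x} → ℝ) (c : ℕ × ℕ)
    [Decidable (p c)] :
    (∑ q : {x // p x}, if q.1 = c then g q else 0) = if h : p c then g ⟨c, h⟩ else 0 := by
  split_ifs with h
  · rw [Finset.sum_eq_single ⟨c, h⟩]
    · simp
    · intro b _ hb
      exact if_neg fun e => hb (Subtype.ext e)
    · simp
  · refine Finset.sum_eq_zero fun q _ => if_neg ?_
    rintro rfl
    exact h q.2

/-- The extension by zero of a function on the square to all pairs of natural numbers. -/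
noncomputable def rectExt (m : ℕ) (g : RectP m m → ℝ) (i j : ℕ) : ℝ :=
  if h : 1 ≤ i ∧ i ≤ m ∧ 1 ≤ j ∧ j ≤ m then g ⟨(i, j), h⟩ else 0

/-- The sum of the values below `(i,j)` of a labeling of the square extended by zero. -/
noncomputable def rectBelow (F : ℕ → ℕ → ℝ) (i j : ℕ) : ℝ :=
  if i = 1 ∧ j = 1 then 1 else F (i - 1) j + F i (j - 1)

/-- The sum of the inverses of the values above `(i,j)` of a labeling of the square extended
by zero. -/
noncomputable def rectAboveInv (m : ℕ) (κ : ℝ) (F : ℕ → ℕ → ℝ) (i j : ℕ) : ℝ :=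
  if i = m ∧ j = m then κ⁻¹ else (F (i + 1) j)⁻¹ + (F i (j + 1))⁻¹

/-- The down-transfer of a labeling of the square, in coordinates. -/
noncomputable def rectDown (F : ℕ → ℕ → ℝ) (i j : ℕ) : ℝ := F i j / rectBelow F i j

/-- The up-transfer of a labeling of the square, in coordinates. -/
noncomputable def rectUp (m : ℕ) (κ : ℝ) (F : ℕ → ℕ → ℝ) (i j : ℕ) : ℝ :=
  1 / (F i j * rectAboveInv m κ F i j)

lemma rectDown_swap (F : ℕ → ℕ → ℝ) (i j : ℕ) :
    rectDown (fun a b => F b a) i j = rectDown F j i := by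
  simp only [rectDown, rectBelow, and_comm, add_comm]

lemma rectUp_swap (m : ℕ) (κ : ℝ) (F : ℕ → ℕ → ℝ) (i j : ℕ) :
    rectUp m κ (fun a b => F b a) i j = rectUp m κ F j i := by
  simp only [rectUp, rectAboveInv, and_comm (a := i = m), add_comm (F j (i + 1))⁻¹]

lemma sum_ite_val_rect {m : ℕ} (g : RectP m m → ℝ) (i j : ℕ) :
    (∑ q, if q.1 = (i, j) then g q else 0) = rectExt m g i j :=
  @sum_ite_val_eq (fun x => 1 ≤ x.1 ∧ x.1 ≤ m ∧ 1 ≤ x.2 ∧ x.2 ≤ m)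
    (inferInstance : Fintype (RectP m m)) g (i, j) _

lemma rectP_lt_iff {m : ℕ} (p q : RectP m m) :
    p < q ↔ (p.1.1 ≤ q.1.1 ∧ p.1.2 ≤ q.1.2) ∧ (p.1.1 < q.1.1 ∨ p.1.2 < q.1.2) := by
  rw [lt_iff_le_not_ge]
  change (p.1.1 ≤ q.1.1 ∧ p.1.2 ≤ q.1.2) ∧ ¬ (q.1.1 ≤ p.1.1 ∧ q.1.2 ≤ p.1.2) ↔ _
  omega

lemma rectP_covBy_iff {m : ℕ} (p q : RectP m m) :
    p ⋖ q ↔ (p.1.1 + 1 = q.1.1 ∧ p.1.2 = q.1.2) ∨ (p.1.1 = q.1.1 ∧ p.1.2 + 1 = q.1.2) := by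
  have hp := p.2
  have hq := q.2
  constructor
  · rintro ⟨h, h'⟩
    rw [rectP_lt_iff] at h
    have hbetween : ∀ a b, ¬ ((1 ≤ a ∧ a ≤ m ∧ 1 ≤ b ∧ b ≤ m) ∧
        ((p.1.1 ≤ a ∧ p.1.2 ≤ b) ∧ (p.1.1 < a ∨ p.1.2 < b)) ∧
        ((a ≤ q.1.1 ∧ b ≤ q.1.2) ∧ (a < q.1.1 ∨ b < q.1.2))) := fun a b ⟨hab, h1, h2⟩ =>
      h' ((rectP_lt_iff p ⟨(a, b), hab⟩).2 h1) ((rectP_lt_iff ⟨(a, b), hab⟩ q).2 h2)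
    have h1 := hbetween (p.1.1 + 1) p.1.2
    have h2 := hbetween p.1.1 (p.1.2 + 1)
    omega
  · intro h
    refine ⟨(rectP_lt_iff p q).2 (by omega), fun r h1 h2 => ?_⟩
    rw [rectP_lt_iff] at h1 h2
    omega

lemma sum_covBy_rect {m : ℕ} (g : RectP m m → ℝ) (x : RectP m m) :
    (∑ y, if y ⋖ x then g y else 0) =
      rectExt m g (x.1.1 - 1) x.1.2 + rectExt m g x.1.1 (x.1.2 - 1) := by
  have h : ∀ y : RectP m m, (if y ⋖ x then g y else 0) =
      (if y.1 = (x.1.1 - 1, x.1.2) then g y else 0) +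
        if y.1 = (x.1.1, x.1.2 - 1) then g y else 0 := by
    intro y
    have hx := x.2
    have hy := y.2
    simp only [rectP_covBy_iff, Prod.ext_iff]
    split_ifs <;> first | omega | simp
  simp only [h, Finset.sum_add_distrib]
  rw [sum_ite_val_rect, sum_ite_val_rect]

lemma sum_covBy_rect' {m : ℕ} (g : RectP m m → ℝ) (x : RectP m m) :
    (∑ y, if x ⋖ y then g y else 0) =
      rectExt m g (x.1.1 + 1) x.1.2 + rectExt m g x.1.1 (x.1.2 + 1) := by
  have h : ∀ y : RectP m m, (if x ⋖ y then g y else 0) =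
      (if y.1 = (x.1.1 + 1, x.1.2) then g y else 0) +
        if y.1 = (x.1.1, x.1.2 + 1) then g y else 0 := by
    intro y
    simp only [rectP_covBy_iff, Prod.ext_iff]
    split_ifs <;> first | omega | simp
  simp only [h, Finset.sum_add_distrib]
  rw [sum_ite_val_rect, sum_ite_val_rect]

lemma isMin_rect_iff {m : ℕ} (x : RectP m m) : IsMin x ↔ x.1.1 = 1 ∧ x.1.2 = 1 := by
  have hx := x.2
  constructor
  · intro h
    have : x.1.1 ≤ 1 ∧ x.1.2 ≤ 1 :=
      h (b := ⟨(1, 1), by dsimp only; omega⟩) ⟨by dsimp only; omega, by dsimp only; omega⟩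
    omega
  · intro h y _
    have hy := y.2
    exact ⟨by omega, by omega⟩

lemma isMax_rect_iff {m : ℕ} (x : RectP m m) : IsMax x ↔ x.1.1 = m ∧ x.1.2 = m := by
  have hx := x.2
  constructor
  · intro h
    have : m ≤ x.1.1 ∧ m ≤ x.1.2 :=
      h (b := ⟨(m, m), by dsimp only; omega⟩) ⟨by dsimp only; omega, by dsimp only; omega⟩
    omega
  · intro h y _
    have hy := y.2
    exact ⟨by omega, by omega⟩

lemma rectExt_apply {m : ℕ} (g : RectP m m → ℝ) (x : RectP m m) :
    rectExt m g x.1.1 x.1.2 = g x := dif_pos x.2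

lemma rectExt_inv {m : ℕ} (g : RectP m m → ℝ) (i j : ℕ) :
    rectExt m (fun y => (g y)⁻¹) i j = (rectExt m g i j)⁻¹ := by
  unfold rectExt
  split_ifs
  · rfl
  · exact inv_zero.symm

lemma sumBelow_rect {m : ℕ} (g : RectP m m → ℝ) (x : RectP m m) :
    sumBelow g x = rectBelow (rectExt m g) x.1.1 x.1.2 :=
  if_congr (isMin_rect_iff x) rfl (sum_covBy_rect g x)

lemma sumAboveInv_rect {m : ℕ} (κ : ℝ) (g : RectP m m → ℝ) (x : RectP m m) :
    sumAboveInv κ g x = rectAboveInv m κ (rectExt m g) x.1.1 x.1.2 :=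
  if_congr (isMax_rect_iff x) rfl <| by rw [sum_covBy_rect', rectExt_inv, rectExt_inv]

/-- `F` is positive on the square `[1,m]²` and vanishes on its outer boundary. -/
structure IsRectLabeling (m : ℕ) (F : ℕ → ℕ → ℝ) : Prop where
  pos : ∀ i j, 1 ≤ i → i ≤ m → 1 ≤ j → j ≤ m → 0 < F i j
  zero : ∀ i j, ¬ (1 ≤ i ∧ i ≤ m ∧ 1 ≤ j ∧ j ≤ m) → F i j = 0

lemma IsRectLabeling.swap {m : ℕ} {F : ℕ → ℕ → ℝ} (h : IsRectLabeling m F) :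
    IsRectLabeling m fun a b => F b a :=
  ⟨fun i j h1 h2 h3 h4 => h.pos j i h3 h4 h1 h2, fun i j hij => h.zero j i (by tauto)⟩

lemma isRectLabeling_rectExt {m : ℕ} {g : RectP m m → ℝ} (hg : ∀ x, 0 < g x) :
    IsRectLabeling m (rectExt m g) := by
  refine ⟨fun i j h1 h2 h3 h4 => ?_, fun i j h => dif_neg h⟩
  rw [rectExt, dif_pos ⟨h1, h2, h3, h4⟩]
  exact hg _

lemma prod_transfer_eq {m : ℕ} {A B : ℕ → ℝ} (hA0 : A 0 = 0) (hBm : B (m + 1) = 0)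
    (hA : ∀ j, 1 ≤ j → j ≤ m → 0 < A j) (hB : ∀ j, 1 ≤ j → j ≤ m → 0 < B j) :
    ∏ j ∈ Finset.Icc 1 m, A j / (B j + A (j - 1)) =
      ∏ j ∈ Finset.Icc 1 m, 1 / (B j * ((A j)⁻¹ + (B (j + 1))⁻¹)) := by
  have key : ∀ k, k < m → (∏ j ∈ Finset.Icc 1 k, A j / (B j + A (j - 1))) *
      (B (k + 1) / (A k + B (k + 1))) =
      ∏ j ∈ Finset.Icc 1 k, 1 / (B j * ((A j)⁻¹ + (B (j + 1))⁻¹)) := by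
    intro k
    induction k with
    | zero =>
      intro h
      have := hB 1 le_rfl h
      simp [hA0, this.ne']
    | succ k ih =>
      intro h
      rw [Finset.prod_Icc_succ_top (by omega), Finset.prod_Icc_succ_top (by omega),
        ← ih (by omega)]
      have h1 := hB (k + 1) (by omega) (by omega)
      have h2 := hB (k + 1 + 1) (by omega) (by omega)
      have h3 := hA (k + 1) (by omega) (by omega)
      have h4 : 0 ≤ A k := by
        rcases Nat.eq_zero_or_pos k with rfl | hk
        · exact hA0.ge
        · exact (hA k hk (by omega)).le
      rw [Nat.add_sub_cancel]
      have h5 : A k + B (k + 1) ≠ 0 := by positivity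
      have h6 : B (k + 1) + A k ≠ 0 := by positivity
      field_simp
      ring
  cases m with
  | zero => simp
  | succ k =>
    rw [Finset.prod_Icc_succ_top (by omega), Finset.prod_Icc_succ_top (by omega),
      ← key k (by omega), hBm, Nat.add_sub_cancel]
    have h1 := hB (k + 1) (by omega) (by omega)
    have h3 := hA (k + 1) (by omega) (by omega)
    have h4 : 0 ≤ A k := by
      rcases Nat.eq_zero_or_pos k with rfl | hk
      · exact hA0.ge
      · exact (hA k hk (by omega)).le
    rw [add_comm (A k), inv_zero, add_zero]
    have h6 : B (k + 1) + A k ≠ 0 := by positivity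
    field_simp

lemma prod_rectDown_succ {m : ℕ} (κ : ℝ) {F : ℕ → ℕ → ℝ} (hF : IsRectLabeling m F) {i : ℕ}
    (hi : 1 ≤ i) (him : i < m) :
    ∏ j ∈ Finset.Icc 1 m, rectDown F (i + 1) j = ∏ j ∈ Finset.Icc 1 m, rectUp m κ F i j := by
  have h := prod_transfer_eq (m := m) (A := F (i + 1)) (B := F i) (hF.zero _ _ (by omega))
    (hF.zero _ _ (by omega)) (fun j h1 h2 => hF.pos _ _ (by omega) (by omega) h1 h2)
    (fun j h1 h2 => hF.pos _ _ (by omega) (by omega) h1 h2)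
  refine Eq.trans (Finset.prod_congr rfl fun j _ => ?_)
    (h.trans (Finset.prod_congr rfl fun j _ => ?_))
  · rw [rectDown, rectBelow, if_neg (by omega), Nat.add_sub_cancel]
  · rw [rectUp, rectAboveInv, if_neg (by omega)]

lemma prod_rectDown_one {m : ℕ} (hm : 1 ≤ m) {F : ℕ → ℕ → ℝ} (hF : IsRectLabeling m F) :
    ∏ j ∈ Finset.Icc 1 m, rectDown F 1 j = F 1 m := by
  have key : ∀ k, 1 ≤ k → k ≤ m → ∏ j ∈ Finset.Icc 1 k, rectDown F 1 j = F 1 k := by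
    intro k hk
    induction k, hk using Nat.le_induction with
    | base => intro _; simp [rectDown, rectBelow]
    | succ k hk ih =>
      intro h
      rw [Finset.prod_Icc_succ_top (by omega), ih (by omega), rectDown, rectBelow,
        if_neg (by omega), hF.zero (1 - 1) _ (by omega), zero_add, Nat.add_sub_cancel]
      exact mul_div_cancel₀ _ (hF.pos 1 k le_rfl (by omega) hk (by omega)).ne'
  exact key m hm le_rfl

lemma prod_rectUp_last {m : ℕ} (hm : 1 ≤ m) {κ : ℝ} {F : ℕ → ℕ → ℝ}
    (hF : IsRectLabeling m F) :
    ∏ j ∈ Finset.Icc 1 m, rectUp m κ F m j = κ / F m 1 := by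
  have key : ∀ k, k < m → ∏ j ∈ Finset.Icc 1 k, rectUp m κ F m j = F m (k + 1) / F m 1 := by
    intro k
    induction k with
    | zero =>
      intro h
      simp [(hF.pos m 1 hm le_rfl le_rfl hm).ne']
    | succ k ih =>
      intro h
      rw [Finset.prod_Icc_succ_top (by omega), ih (by omega), rectUp, rectAboveInv,
        if_neg (by omega), hF.zero (m + 1) _ (by omega), inv_zero, zero_add]
      have := hF.pos m (k + 1) hm le_rfl (by omega) (by omega)
      field_simp
  obtain ⟨k, rfl⟩ : ∃ k, m = k + 1 := ⟨m - 1, by omega⟩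
  rw [Finset.prod_Icc_succ_top (by omega), key k (by omega), rectUp, rectAboveInv,
    if_pos ⟨rfl, rfl⟩]
  have := hF.pos (k + 1) (k + 1) hm le_rfl hm le_rfl
  field_simp

lemma STword_row {m : ℕ} (κ : ℝ) {w : RectP m m → ℝ} {W : ℕ → ℕ → ℝ}
    (h : ∀ q, w q = W q.1.1 q.1.2) {i : ℕ} (hi : 1 ≤ i) (him : i ≤ m) :
    STword m m κ w i = ∏ j ∈ Finset.Icc 1 m, W i j := by
  rw [STword, if_pos him]
  refine Finset.prod_congr rfl fun j hj => ?_
  rw [Finset.mem_Icc] at hj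
  exact (dif_pos ⟨hi, him, hj.1, hj.2⟩).trans (h _)

lemma STword_col {m : ℕ} (κ : ℝ) {w : RectP m m → ℝ} {W : ℕ → ℕ → ℝ}
    (h : ∀ q, w q = W q.1.1 q.1.2) {i : ℕ} (hi : 1 ≤ i) (him : i ≤ m) :
    STword m m κ w (i + m) = κ / ∏ j ∈ Finset.Icc 1 m, W j i := by
  rw [STword, if_neg (by omega), Nat.add_sub_cancel]
  congr 1
  refine Finset.prod_congr rfl fun j hj => ?_
  rw [Finset.mem_Icc] at hj
  exact (dif_pos ⟨hj.1, hj.2, hi, him⟩).trans (h _)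

lemma STword_down_one {m : ℕ} (hm : 1 ≤ m) (κ : ℝ) {F : ℕ → ℕ → ℝ} (hF : IsRectLabeling m F)
    {w : RectP m m → ℝ} (hw : ∀ q, w q = rectDown F q.1.1 q.1.2) :
    STword m m κ w 1 = F 1 m := by
  rw [STword_row κ hw le_rfl hm, prod_rectDown_one hm hF]

lemma STword_up_last {m : ℕ} (hm : 1 ≤ m) {κ : ℝ} (hκ : 0 < κ) {F : ℕ → ℕ → ℝ}
    (hF : IsRectLabeling m F) {w : RectP m m → ℝ}
    (hw : ∀ q, w q = rectUp m κ F q.1.1 q.1.2) :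
    STword m m κ w (2 * m) = F 1 m := by
  rw [two_mul, STword_col κ hw hm le_rfl]
  simp only [← rectUp_swap m κ F]
  rw [prod_rectUp_last hm hF.swap, div_div_cancel₀ hκ.ne']

/-- Passing from the up-transfer to the down-transfer shifts the Stanley–Thomas word. -/
lemma STword_down_succ {m : ℕ} {κ : ℝ} {F : ℕ → ℕ → ℝ}
    (hF : IsRectLabeling m F) {w w' : RectP m m → ℝ}
    (hw : ∀ q, w q = rectUp m κ F q.1.1 q.1.2) (hw' : ∀ q, w' q = rectDown F q.1.1 q.1.2)
    {i : ℕ} (hi : 1 ≤ i) (him : i < 2 * m) :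
    STword m m κ w' (i + 1) = STword m m κ w i := by
  rcases lt_trichotomy i m with h | rfl | h
  · rw [STword_row κ hw' (by omega) h, STword_row κ hw hi h.le, prod_rectDown_succ κ hF hi h]
  · rw [add_comm, STword_col κ hw' le_rfl hi, STword_row κ hw hi le_rfl, prod_rectUp_last hi hF]
    simp only [← rectDown_swap F]
    rw [prod_rectDown_one hi hF.swap]
  · obtain ⟨k, rfl⟩ : ∃ k, i = k + m := ⟨i - m, by omega⟩
    rw [add_right_comm, STword_col κ hw' (by omega) (by omega),
      STword_col κ hw (by omega) (by omega)]
    simp only [← rectDown_swap F, ← rectUp_swap m κ F]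
    rw [prod_rectDown_succ κ hF.swap (by omega) (by omega)]

lemma rkRect_strictMono (m : ℕ) : StrictMono (rkRect m m) := by
  intro a b hab
  have h1 : a.1.1 ≤ b.1.1 ∧ a.1.2 ≤ b.1.2 := hab.le
  have h2 : ¬ (b.1.1 ≤ a.1.1 ∧ b.1.2 ≤ a.1.2) := hab.not_ge
  have ha := a.2
  unfold rkRect
  omega

lemma exists_rectTransfer_RowAB {m : ℕ} {κ : ℝ} (hκ : 0 < κ) {w : RectP m m → ℝ}
    (hw : ∀ x, 0 < w x) :
    ∃ F, IsRectLabeling m F ∧ (∀ q, w q = rectUp m κ F q.1.1 q.1.2) ∧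
      ∀ q, RowAB κ (rkRect m m) (2 * m - 2) w q = rectDown F q.1.1 q.1.2 := by
  obtain ⟨f, hf, h1, h2⟩ := exists_transfer_RowAB hκ (rkRect_strictMono m) (r := 2 * m - 2)
    (fun x => by have := x.2; unfold rkRect; omega) hw
  refine ⟨rectExt m f, isRectLabeling_rectExt hf, fun q => ?_, fun q => ?_⟩
  · rw [h1, sumAboveInv_rect, rectUp, rectExt_apply]
  · rw [h2, sumBelow_rect, rectDown, rectExt_apply]

lemma RowAB_rect_pos {m : ℕ} {κ : ℝ} (hκ : 0 < κ) {w : RectP m m → ℝ} (hw : ∀ x, 0 < w x)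
    (x : RectP m m) : 0 < RowAB κ (rkRect m m) (2 * m - 2) w x := by
  obtain ⟨f, hf, -, h2⟩ := exists_transfer_RowAB hκ (rkRect_strictMono m) (r := 2 * m - 2)
    (fun x => by have := x.2; unfold rkRect; omega) hw
  rw [h2]
  exact div_pos (hf x) (sumBelow_pos fun y _ => hf y)

lemma STword_pos {m : ℕ} {κ : ℝ} (hκ : 0 < κ) {w : RectP m m → ℝ} (hw : ∀ x, 0 < w x) (i : ℕ) :
    0 < STword m m κ w i := by
  unfold STword
  split_ifs
  · refine Finset.prod_pos fun j _ => ?_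
    split_ifs
    exacts [hw _, one_pos]
  · refine div_pos hκ (Finset.prod_pos fun j _ => ?_)
    split_ifs
    exacts [hw _, one_pos]

theorem STword_eq_sqrt {n : ℕ} (hn : 1 ≤ n) {κ : ℝ} (hκ : 0 < κ) {w : RectP n n → ℝ}
    (hw : ∀ p, 0 < w p)
    (hrow : (RowAB κ (rkRect n n) (2 * n - 2))^[n] w = fun p => w (flipRect n p))
    {i : ℕ} (hi : 1 ≤ i) (hin : i ≤ 2 * n) : STword n n κ w i = Real.sqrt κ := by
  set v : ℕ → RectP n n → ℝ := fun k => (RowAB κ (rkRect n n) (2 * n - 2))^[k] w with hv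
  have hvs : ∀ k, v (k + 1) = RowAB κ (rkRect n n) (2 * n - 2) (v k) := fun k =>
    Function.iterate_succ_apply' _ _ _
  have hpos : ∀ k x, 0 < v k x := by
    intro k
    induction k with
    | zero => exact hw
    | succ k ih => rw [hvs]; exact RowAB_rect_pos hκ ih
  have hshift : ∀ k i, 1 ≤ i → i < 2 * n →
      STword n n κ (v (k + 1)) (i + 1) = STword n n κ (v k) i := by
    intro k i h1 h2
    obtain ⟨F, hF, hup, hdown⟩ := exists_rectTransfer_RowAB hκ (hpos k)
    rw [hvs]
    exact STword_down_succ hF hup hdown h1 h2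
  have hwrap : ∀ k, STword n n κ (v (k + 1)) 1 = STword n n κ (v k) (2 * n) := by
    intro k
    obtain ⟨F, hF, hup, hdown⟩ := exists_rectTransfer_RowAB hκ (hpos k)
    rw [hvs, STword_down_one hn κ hF hdown, STword_up_last hn hκ hF hup]
  have hshifts : ∀ s k i, 1 ≤ i → i + k ≤ 2 * n →
      STword n n κ (v (s + k)) (i + k) = STword n n κ (v s) i := by
    intro s k i h1 h2
    induction k with
    | zero => rfl
    | succ k ih =>
      rw [← add_assoc, ← add_assoc, hshift _ _ (by omega) (by omega), ih (by omega)]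
  have hwW : ∀ q, w q = rectExt n w q.1.1 q.1.2 := fun q => (rectExt_apply w q).symm
  have hflip : ∀ q, v n q = (fun a b => rectExt n w b a) q.1.1 q.1.2 := by
    intro q
    simp only [hv, hrow]
    exact (rectExt_apply w (flipRect n q)).symm
  have hinv : STword n n κ w i = κ / STword n n κ w i := by
    rcases le_or_gt i n with h | h
    · have h0 := hshifts 0 n i hi (by omega)
      rw [zero_add, STword_col κ (W := fun a b => rectExt n w b a) hflip hi h, ← STword_row κ hwW hi h] at h0
      exact h0.symm
    · obtain ⟨k, rfl⟩ : ∃ k, i = k + n := ⟨i - n, by omega⟩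
      have h0 := hshifts 0 (n - k) (k + n) hi (by omega)
      have h1 := hshifts (n - k + 1) (k - 1) 1 le_rfl (by omega)
      rw [show k + n + (n - k) = 2 * n by omega, zero_add] at h0
      rw [hwrap, show n - k + 1 + (k - 1) = n by omega, show 1 + (k - 1) = k by omega, h0,
        STword_row κ (W := fun a b => rectExt n w b a) hflip (by omega) (by omega)] at h1
      rw [STword_col κ hwW (by omega) (by omega), div_div_cancel₀ hκ.ne',
        ← STword_col κ hwW (by omega) (by omega)]
      exact h1.symm
  have hp := STword_pos hκ hw i
  rw [eq_comm, Real.sqrt_eq_iff_mul_self_eq hκ.le hp.le]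
  nth_rewrite 2 [hinv]
  field_simp

end Rectangle

section FilterToggles

variable {P : Type}

lemma emb_ne_bot (p : P) : emb p ≠ (⊥ : Phat P) := WithBot.coe_ne_bot

lemma emb_ne_topHat (p : P) : emb p ≠ topHat P := fun h =>
  WithTop.coe_ne_top (WithBot.coe_injective h)

lemma emb_injective : Function.Injective (emb : P → Phat P) := fun _ _ h =>
  WithTop.coe_injective (WithBot.coe_injective h)

lemma sum_Phat [Fintype P] (φ : Phat P → ℝ) :
    ∑ y, φ y = φ ⊥ + (φ (topHat P) + ∑ p, φ (emb p)) :=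
  (Fintype.sum_option (α := WithTop P) φ).trans
    (congrArg (φ ⊥ + ·) (Fintype.sum_option (α := P) fun y => φ (WithBot.some y)))

variable [PartialOrder P]

lemma emb_covBy_emb {p q : P} : emb p ⋖ emb q ↔ p ⋖ q :=
  WithBot.coe_covBy_coe.trans WithTop.coe_covBy_coe

lemma emb_covBy_topHat {p : P} : emb p ⋖ topHat P ↔ IsMax p :=
  WithBot.coe_covBy_coe.trans WithTop.coe_covBy_top

lemma bot_covBy_emb {p : P} : (⊥ : Phat P) ⋖ emb p ↔ IsMin p := by
  refine WithBot.bot_covBy_coe.trans ⟨fun h b hb => ?_, fun h b hb => ?_⟩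
  · exact WithTop.coe_le_coe.1 (h (WithTop.coe_le_coe.2 hb))
  · induction b with
    | top => exact le_top
    | coe b => exact WithTop.coe_le_coe.2 (h (WithTop.coe_le_coe.1 hb))

variable [Fintype P]

lemma covSumBelow_emb {σ : Phat P → ℝ} (h : σ ⊥ = 1) (p : P) :
    covSumBelow σ (emb p) = sumBelow (fun q => σ (emb q)) p := by
  have htop : ¬ topHat P ⋖ emb p := fun h =>
    h.lt.not_ge (WithBot.coe_le_coe.2 le_top)
  simp only [covSumBelow, sum_Phat, bot_covBy_emb, emb_covBy_emb, if_neg htop, zero_add,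
    sumBelow, h]
  split_ifs with hp
  · rw [Finset.sum_eq_zero fun y _ => if_neg fun hy : y ⋖ p => hp.not_lt hy.lt, add_zero]
  · exact zero_add _

lemma covSumAboveInv_emb {κ : ℝ} {σ : Phat P → ℝ} (h : σ (topHat P) = κ) (p : P) :
    covSumAboveInv σ (emb p) = sumAboveInv κ (fun q => σ (emb q)) p := by
  have hbot : ¬ emb p ⋖ (⊥ : Phat P) := fun h => not_lt_bot h.lt
  simp only [covSumAboveInv, sum_Phat, emb_covBy_topHat, emb_covBy_emb, if_neg hbot, zero_add,
    sumAboveInv, h]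
  split_ifs with hp
  · rw [Finset.sum_eq_zero fun y _ => if_neg fun hy : p ⋖ y => hp.not_lt hy.lt, add_zero]
  · exact zero_add _

/-- The birational order filter rank toggle on labelings of `P`, the adjoined minimum and
maximum carrying the values `1` and `κ`. -/
noncomputable def filterToggle (κ : ℝ) (rk : P → ℕ) (i : ℕ) (g : P → ℝ) : P → ℝ := fun x =>
  if rk x = i then sumBelow g x / (g x * sumAboveInv κ g x) else g x

lemma applyB_spec {κ : ℝ} (rk : P → ℕ) {σ : Phat P → ℝ} (h0 : σ ⊥ = 1)
    (h1 : σ (topHat P) = κ) (l : List ℕ) :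
    applyB rk l σ ⊥ = 1 ∧ applyB rk l σ (topHat P) = κ ∧
      (fun p => applyB rk l σ (emb p)) = l.foldr (filterToggle κ rk) fun p => σ (emb p) := by
  induction l with
  | nil => exact ⟨h0, h1, rfl⟩
  | cons i l ih =>
    obtain ⟨i0, i1, i2⟩ := ih
    refine ⟨?_, ?_, ?_⟩
    · refine (if_neg ?_).trans i0
      rintro ⟨p, -, hp⟩
      exact emb_ne_bot p hp.symm
    · refine (if_neg ?_).trans i1
      rintro ⟨p, -, hp⟩
      exact emb_ne_topHat p hp.symm
    · ext p
      rw [List.foldr_cons, ← i2]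
      simp only [applyB, rankToggleB, filterToggle, covSumBelow_emb i0, covSumAboveInv_emb i1]
      refine if_congr ⟨?_, fun hp => ⟨p, hp, rfl⟩⟩ rfl rfl
      rintro ⟨q, hq, hpq⟩
      rwa [emb_injective hpq]

lemma filterToggle_pos {κ : ℝ} (hκ : 0 < κ) (rk : P → ℕ) (i : ℕ) {g : P → ℝ}
    (hg : ∀ x, 0 < g x) (x : P) : 0 < filterToggle κ rk i g x := by
  unfold filterToggle
  split_ifs
  · exact div_pos (sumBelow_pos fun y _ => hg y)
      (mul_pos (hg x) (sumAboveInv_pos hκ fun y _ => hg y))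
  · exact hg x

lemma foldr_filterToggle_pos {κ : ℝ} (hκ : 0 < κ) (rk : P → ℕ) (l : List ℕ) {g : P → ℝ}
    (hg : ∀ x, 0 < g x) : ∀ x, 0 < l.foldr (filterToggle κ rk) g x := by
  induction l with
  | nil => exact hg
  | cons i l ih => exact filterToggle_pos hκ rk i ih

lemma sumBelow_congr {g g' : P → ℝ} {x : P} (h : ∀ y, y ⋖ x → g y = g' y) :
    sumBelow g x = sumBelow g' x :=
  if_congr Iff.rfl rfl (Finset.sum_congr rfl fun y _ => by split_ifs with hy; exacts [h y hy, rfl])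

lemma sumAboveInv_congr {κ : ℝ} {g g' : P → ℝ} {x : P} (h : ∀ y, x ⋖ y → g y = g' y) :
    sumAboveInv κ g x = sumAboveInv κ g' x :=
  if_congr Iff.rfl rfl (Finset.sum_congr rfl fun y _ => by
    split_ifs with hy
    exacts [by rw [h y hy], rfl])

lemma drop_range_eq_cons {m r : ℕ} (h : m ≤ r) :
    (List.range (r + 1)).drop m = m :: (List.range (r + 1)).drop (m + 1) := by
  rw [List.drop_eq_getElem_cons (by simpa using by omega), List.getElem_range]

/-- The effect of the sweep `𝐭_m 𝐭_{m+1} ⋯ 𝐭_r`. -/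
lemma foldr_drop_range_spec {κ : ℝ} {rk : P → ℕ} (hrk : StrictMono rk) {r : ℕ}
    (hr : ∀ x, rk x ≤ r) (g : P → ℝ) {m : ℕ} (hm : m ≤ r + 1) :
    let h := ((List.range (r + 1)).drop m).foldr (filterToggle κ rk) g
    (∀ x, rk x < m → h x = g x) ∧
      ∀ x, m ≤ rk x → h x = sumBelow g x / (g x * sumAboveInv κ h x) := by
  induction hm using Nat.decreasingInduction with
  | self =>
    refine ⟨fun x _ => ?_, fun x hx => ?_⟩
    · rw [List.drop_eq_nil_of_le (by simp)]
      rfl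
    · have := hr x
      omega
  | of_succ m hm ih =>
    obtain ⟨ih1, ih2⟩ := ih
    rw [drop_range_eq_cons (by omega)]
    simp only [List.foldr_cons]
    set h' := ((List.range (r + 1)).drop (m + 1)).foldr (filterToggle κ rk) g with hh'
    have habove : ∀ x, m ≤ rk x →
        sumAboveInv κ (filterToggle κ rk m h') x = sumAboveInv κ h' x := fun x hx =>
      sumAboveInv_congr fun y hy => if_neg (by have := hrk hy.lt; omega)
    refine ⟨fun x hx => ?_, fun x hx => ?_⟩
    · rw [filterToggle, if_neg (by omega), ih1 x (by omega)]
    · rw [habove x hx]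
      rcases hx.eq_or_lt with hx | hx
      · rw [filterToggle, if_pos hx.symm, ih1 x (by omega)]
        congr 1
        exact sumBelow_congr fun y hy => ih1 y (by have := hrk hy.lt; omega)
      · rw [filterToggle, if_neg (by omega), ih2 x hx]

/-- Order filter rowmotion on labelings of `P`. -/
noncomputable def filterRow (κ : ℝ) (rk : P → ℕ) (r : ℕ) (g : P → ℝ) : P → ℝ :=
  (List.range (r + 1)).foldr (filterToggle κ rk) g

lemma filterRow_apply {κ : ℝ} {rk : P → ℕ} (hrk : StrictMono rk) {r : ℕ}
    (hr : ∀ x, rk x ≤ r) (g : P → ℝ) (x : P) :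
    filterRow κ rk r g x = sumBelow g x / (g x * sumAboveInv κ (filterRow κ rk r g) x) :=
  (foldr_drop_range_spec hrk hr g (Nat.zero_le _)).2 x (Nat.zero_le _)

/-- The value of rowvacuation at an element of rank `i` is that of the `(i+1)`-st power of
rowmotion. -/
lemma foldr_rvacWordB {κ : ℝ} {rk : P → ℕ} (hrk : StrictMono rk) {r : ℕ}
    (hr : ∀ x, rk x ≤ r) (hcov : ∀ x y, x ⋖ y → rk y = rk x + 1) (g : P → ℝ) (x : P) :
    (rvacWordB r).foldr (filterToggle κ rk) g x = (filterRow κ rk r)^[rk x + 1] g x := by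
  have key : ∀ k, k ≤ r + 1 → ∀ x,
      (((List.range (r + 1)).drop k).foldr
        (fun k acc => (List.range (r + 1)).drop (r - k) ++ acc) []).foldr
          (filterToggle κ rk) g x =
        (filterRow κ rk r)^[min (r + 1 - k) (rk x + 1)] g x := by
    intro k hk
    induction hk using Nat.decreasingInduction with
    | self =>
      intro x
      rw [List.drop_eq_nil_of_le (by simp)]
      simp
    | of_succ k hk ih =>
      rw [drop_range_eq_cons (by omega), List.foldr_cons, List.foldr_append]
      set h := (((List.range (r + 1)).drop (k + 1)).foldr
        (fun k acc => (List.range (r + 1)).drop (r - k) ++ acc) []).foldr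
          (filterToggle κ rk) g with hh
      obtain ⟨s1, s2⟩ := foldr_drop_range_spec (κ := κ) hrk hr h (m := r - k) (by omega)
      intro x
      induction x using WellFoundedGT.induction with
      | ind x ihx =>
        by_cases hx : rk x < r - k
        · rw [s1 x hx, ih, min_eq_right (by omega), min_eq_right (by omega)]
        · rw [s2 x (by omega), min_eq_left (by omega), show r + 1 - k = r - k + 1 by omega,
            Function.iterate_succ_apply', filterRow_apply hrk hr]
          have e1 : h x = (filterRow κ rk r)^[r - k] g x := by
            rw [ih, min_eq_left (by omega), Nat.add_sub_add_right]
          have e2 : sumBelow h x = sumBelow ((filterRow κ rk r)^[r - k] g) x :=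
            sumBelow_congr fun y hy => by
              have := hcov _ _ hy
              rw [ih, min_eq_left (by omega), Nat.add_sub_add_right]
          rw [e1, e2]
          congr 2
          refine sumAboveInv_congr fun y hy => ?_
          have := hcov _ _ hy
          rw [ihx y hy.lt, min_eq_left (by omega), show r + 1 - k = r - k + 1 by omega,
            Function.iterate_succ_apply']
  have h0 := key 0 (Nat.zero_le _) x
  rw [min_eq_right (by have := hr x; omega)] at h0
  exact h0

end FilterToggles

section Triangle

/-- The extension by zero of a function on `Aⁿ` to all pairs of natural numbers. -/
noncomputable def anExt (n : ℕ) (g : AnP n → ℝ) (i j : ℕ) : ℝ :=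
  if h : 1 ≤ i ∧ i ≤ j ∧ j ≤ n then g ⟨(i, j), h⟩ else 0

/-- The sum of the values below `[i,j]` of a labeling of `Aⁿ` extended by zero. -/
noncomputable def anBelow (G : ℕ → ℕ → ℝ) (i j : ℕ) : ℝ :=
  if i = j then 1 else G (i + 1) j + G i (j - 1)

/-- The sum of the inverses of the values above `[i,j]` of a labeling of `Aⁿ` extended
by zero. -/
noncomputable def anAboveInv (n : ℕ) (κ : ℝ) (G : ℕ → ℕ → ℝ) (i j : ℕ) : ℝ :=
  if i = 1 ∧ j = n then κ⁻¹ else (G (i - 1) j)⁻¹ + (G i (j + 1))⁻¹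

lemma sum_ite_val_an {n : ℕ} (g : AnP n → ℝ) (i j : ℕ) :
    (∑ q, if q.1 = (i, j) then g q else 0) = anExt n g i j :=
  @sum_ite_val_eq (fun x => 1 ≤ x.1 ∧ x.1 ≤ x.2 ∧ x.2 ≤ n)
    (inferInstance : Fintype (AnP n)) g (i, j) _

lemma anP_lt_iff {n : ℕ} (p q : AnP n) :
    p < q ↔ (q.1.1 ≤ p.1.1 ∧ p.1.2 ≤ q.1.2) ∧ (q.1.1 < p.1.1 ∨ p.1.2 < q.1.2) := by
  rw [lt_iff_le_not_ge]
  change (q.1.1 ≤ p.1.1 ∧ p.1.2 ≤ q.1.2) ∧ ¬ (p.1.1 ≤ q.1.1 ∧ q.1.2 ≤ p.1.2) ↔ _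
  omega

lemma anP_covBy_iff {n : ℕ} (p q : AnP n) :
    p ⋖ q ↔ (q.1.1 + 1 = p.1.1 ∧ p.1.2 = q.1.2) ∨ (p.1.1 = q.1.1 ∧ p.1.2 + 1 = q.1.2) := by
  have hp := p.2
  have hq := q.2
  constructor
  · rintro ⟨h, h'⟩
    rw [anP_lt_iff] at h
    have hbetween : ∀ a b, ¬ ((1 ≤ a ∧ a ≤ b ∧ b ≤ n) ∧
        ((a ≤ p.1.1 ∧ p.1.2 ≤ b) ∧ (a < p.1.1 ∨ p.1.2 < b)) ∧
        ((q.1.1 ≤ a ∧ b ≤ q.1.2) ∧ (q.1.1 < a ∨ b < q.1.2))) := fun a b ⟨hab, h1, h2⟩ =>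
      h' ((anP_lt_iff p ⟨(a, b), hab⟩).2 h1) ((anP_lt_iff ⟨(a, b), hab⟩ q).2 h2)
    have h1 := hbetween (p.1.1 - 1) p.1.2
    have h2 := hbetween p.1.1 (p.1.2 + 1)
    omega
  · intro h
    refine ⟨(anP_lt_iff p q).2 (by omega), fun r h1 h2 => ?_⟩
    rw [anP_lt_iff] at h1 h2
    omega

lemma sum_covBy_an {n : ℕ} (g : AnP n → ℝ) (x : AnP n) :
    (∑ y, if y ⋖ x then g y else 0) =
      anExt n g (x.1.1 + 1) x.1.2 + anExt n g x.1.1 (x.1.2 - 1) := by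
  have h : ∀ y : AnP n, (if y ⋖ x then g y else 0) =
      (if y.1 = (x.1.1 + 1, x.1.2) then g y else 0) +
        if y.1 = (x.1.1, x.1.2 - 1) then g y else 0 := by
    intro y
    have hx := x.2
    have hy := y.2
    simp only [anP_covBy_iff, Prod.ext_iff]
    split_ifs <;> first | omega | simp
  simp only [h, Finset.sum_add_distrib]
  rw [sum_ite_val_an, sum_ite_val_an]

lemma sum_covBy_an' {n : ℕ} (g : AnP n → ℝ) (x : AnP n) :
    (∑ y, if x ⋖ y then g y else 0) =
      anExt n g (x.1.1 - 1) x.1.2 + anExt n g x.1.1 (x.1.2 + 1) := by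
  have h : ∀ y : AnP n, (if x ⋖ y then g y else 0) =
      (if y.1 = (x.1.1 - 1, x.1.2) then g y else 0) +
        if y.1 = (x.1.1, x.1.2 + 1) then g y else 0 := by
    intro y
    have hx := x.2
    have hy := y.2
    simp only [anP_covBy_iff, Prod.ext_iff]
    split_ifs <;> first | omega | simp
  simp only [h, Finset.sum_add_distrib]
  rw [sum_ite_val_an, sum_ite_val_an]

lemma isMin_an_iff {n : ℕ} (x : AnP n) : IsMin x ↔ x.1.1 = x.1.2 := by
  have hx := x.2
  constructor
  · intro h
    have : x.1.1 ≤ x.1.1 ∧ x.1.2 ≤ x.1.1 :=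
      h (b := ⟨(x.1.1, x.1.1), by dsimp only; omega⟩) ⟨le_refl _, by dsimp only; omega⟩
    omega
  · intro h y hyx
    have hy := y.2
    have hyx' : x.1.1 ≤ y.1.1 ∧ y.1.2 ≤ x.1.2 := hyx
    exact ⟨by omega, by omega⟩

lemma isMax_an_iff {n : ℕ} (x : AnP n) : IsMax x ↔ x.1.1 = 1 ∧ x.1.2 = n := by
  have hx := x.2
  constructor
  · intro h
    have : x.1.1 ≤ 1 ∧ n ≤ x.1.2 :=
      h (b := ⟨(1, n), by dsimp only; omega⟩) ⟨by dsimp only; omega, by dsimp only; omega⟩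
    omega
  · intro h y _
    have hy := y.2
    exact ⟨by omega, by omega⟩

lemma anExt_apply {n : ℕ} (g : AnP n → ℝ) (x : AnP n) : anExt n g x.1.1 x.1.2 = g x :=
  dif_pos x.2

lemma anExt_inv {n : ℕ} (g : AnP n → ℝ) (i j : ℕ) :
    anExt n (fun y => (g y)⁻¹) i j = (anExt n g i j)⁻¹ := by
  unfold anExt
  split_ifs
  · rfl
  · exact inv_zero.symm

lemma sumBelow_an {n : ℕ} (g : AnP n → ℝ) (x : AnP n) :
    sumBelow g x = anBelow (anExt n g) x.1.1 x.1.2 :=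
  if_congr (isMin_an_iff x) rfl (sum_covBy_an g x)

lemma sumAboveInv_an {n : ℕ} (κ : ℝ) (g : AnP n → ℝ) (x : AnP n) :
    sumAboveInv κ g x = anAboveInv n κ (anExt n g) x.1.1 x.1.2 :=
  if_congr (isMax_an_iff x) rfl <| by rw [sum_covBy_an', anExt_inv, anExt_inv]

lemma rkAn_strictMono (n : ℕ) : StrictMono (rkAn n) := by
  intro a b hab
  rw [anP_lt_iff] at hab
  have ha := a.2
  have hb := b.2
  unfold rkAn
  omega

lemma rkAn_le {n : ℕ} (x : AnP n) : rkAn n x ≤ n - 1 := by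
  have hx := x.2
  unfold rkAn
  omega

lemma rkAn_covBy {n : ℕ} {x y : AnP n} (h : x ⋖ y) : rkAn n y = rkAn n x + 1 := by
  rw [anP_covBy_iff] at h
  have hx := x.2
  have hy := y.2
  unfold rkAn
  omega

/-- `a t` is the orbit of a labeling of `Aⁿ` under order filter rowmotion, in coordinates. -/
structure IsAnOrbit (n : ℕ) (κ : ℝ) (a : ℕ → ℕ → ℕ → ℝ) : Prop where
  pos : ∀ t i j, 1 ≤ i → i ≤ j → j ≤ n → 0 < a t i j
  zero : ∀ t i j, ¬ (1 ≤ i ∧ i ≤ j ∧ j ≤ n) → a t i j = 0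
  step : ∀ t i j, 1 ≤ i → i ≤ j → j ≤ n →
    a (t + 1) i j = anBelow (a t) i j / (a t i j * anAboveInv n κ (a (t + 1)) i j)

lemma isAnOrbit_iterate {n : ℕ} {κ : ℝ} (hκ : 0 < κ) {g : AnP n → ℝ} (hg : ∀ x, 0 < g x) :
    IsAnOrbit n κ fun t => anExt n ((filterRow κ (rkAn n) (n - 1))^[t] g) := by
  have hpos : ∀ t x, 0 < (filterRow κ (rkAn n) (n - 1))^[t] g x := by
    intro t
    induction t with
    | zero => exact hg
    | succ t ih =>
      rw [Function.iterate_succ_apply']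
      exact foldr_filterToggle_pos hκ _ _ ih
  refine ⟨fun t i j h1 h2 h3 => ?_, fun t i j h => dif_neg h, fun t i j h1 h2 h3 => ?_⟩
  · rw [anExt, dif_pos ⟨h1, h2, h3⟩]
    exact hpos _ _
  · have key : ∀ x : AnP n, (filterRow κ (rkAn n) (n - 1))^[t + 1] g x =
        sumBelow ((filterRow κ (rkAn n) (n - 1))^[t] g) x /
          ((filterRow κ (rkAn n) (n - 1))^[t] g x *
            sumAboveInv κ ((filterRow κ (rkAn n) (n - 1))^[t + 1] g) x) := by
      rw [Function.iterate_succ_apply']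
      exact filterRow_apply (rkAn_strictMono n) rkAn_le _
    simp only [sumBelow_an, sumAboveInv_an] at key
    simp only [← anExt_apply] at key
    exact key ⟨(i, j), h1, h2, h3⟩

/-- The embedding of an orbit of labelings of `Aⁿ` into labelings of the square. -/
noncomputable def orbitEmbed (n : ℕ) (κ : ℝ) (a : ℕ → ℕ → ℕ → ℝ) (t i j : ℕ) : ℝ :=
  if 1 ≤ i ∧ i ≤ n + 1 ∧ 1 ≤ j ∧ j ≤ n + 1 then
    if n + 2 < i + j then 4 * κ * a t (n + 2 - i) (j - 1)
    else if i + j = n + 2 then 2 * κ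
    else κ / a (t + (n + 2 - i - j)) j (n + 1 - i)
  else 0

section

variable {n : ℕ} {κ : ℝ} {a : ℕ → ℕ → ℕ → ℝ}

lemma orbitEmbed_upper (ha : IsAnOrbit n κ a) (t : ℕ) {i j : ℕ} (hi : i ≤ n + 2)
    (h : n + 2 < i + j) :
    orbitEmbed n κ a t i j = 4 * κ * a t (n + 2 - i) (j - 1) := by
  unfold orbitEmbed
  split_ifs with h'
  · rfl
  · rw [ha.zero _ _ _ (by omega), mul_zero]

lemma orbitEmbed_middle (t : ℕ) {i j : ℕ} (hi : 1 ≤ i) (hj : 1 ≤ j) (h : i + j = n + 2) :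
    orbitEmbed n κ a t i j = 2 * κ := by
  rw [orbitEmbed, if_pos (by omega), if_neg (by omega), if_pos h]

lemma orbitEmbed_lower (ha : IsAnOrbit n κ a) (t : ℕ) {i j : ℕ} (h : i + j < n + 2) :
    orbitEmbed n κ a t i j = κ / a (t + (n + 2 - i - j)) j (n + 1 - i) := by
  unfold orbitEmbed
  split_ifs with h' <;> first | omega | skip
  · rfl
  · rw [ha.zero _ _ _ (by omega), div_zero]

lemma isRectLabeling_orbitEmbed (hκ : 0 < κ) (ha : IsAnOrbit n κ a) (t : ℕ) :
    IsRectLabeling (n + 1) (orbitEmbed n κ a t) := by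
  refine ⟨fun i j h1 h2 h3 h4 => ?_, fun i j h => if_neg h⟩
  rcases lt_trichotomy (i + j) (n + 2) with h | h | h
  · rw [orbitEmbed_lower ha t h]
    exact div_pos hκ (ha.pos _ _ _ (by omega) (by omega) (by omega))
  · rw [orbitEmbed_middle t h1 h3 h]
    positivity
  · rw [orbitEmbed_upper ha t (by omega) h]
    have := ha.pos t (n + 2 - i) (j - 1) (by omega) (by omega) (by omega)
    positivity

/-- Consecutive embedded labelings are related by rowmotion of the square: the up-transfer of
the later one is the down-transfer of the earlier one. -/
lemma rectUp_orbitEmbed (hκ : 0 < κ) (ha : IsAnOrbit n κ a) (hn : 1 ≤ n) (t : ℕ) {i j : ℕ}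
    (hi : 1 ≤ i) (hin : i ≤ n + 1) (hj : 1 ≤ j) (hjn : j ≤ n + 1) :
    rectUp (n + 1) (4 * κ ^ 2) (orbitEmbed n κ a (t + 1)) i j =
      rectDown (orbitEmbed n κ a t) i j := by
  unfold rectUp rectDown
  have hnz : ∀ s k l, 1 ≤ k → k ≤ l → l ≤ n → a s k l ≠ 0 ∧ a (s + 1) k l ≠ 0 ∧
      anBelow (a s) k l ≠ 0 ∧ anAboveInv n κ (a (s + 1)) k l ≠ 0 := by
    intro s k l h1 h2 h3
    have hp := (ha.pos (s + 1) k l h1 h2 h3).ne'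
    refine ⟨(ha.pos s k l h1 h2 h3).ne', hp, fun h => hp ?_, fun h => hp ?_⟩
    · rw [ha.step s k l h1 h2 h3, h, zero_div]
    · rw [ha.step s k l h1 h2 h3, h, mul_zero, div_zero]
  rcases lt_trichotomy (i + j) (n + 2) with h | h | h
  · have e1 : rectAboveInv (n + 1) (4 * κ ^ 2) (orbitEmbed n κ a (t + 1)) i j =
        κ⁻¹ * anBelow (a (t + (n + 2 - i - j))) j (n + 1 - i) := by
      rw [rectAboveInv, if_neg (by omega), anBelow]
      split_ifs with hd
      · rw [orbitEmbed_middle _ (by omega) (by omega) (by omega),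
          orbitEmbed_middle _ (by omega) (by omega) (by omega)]
        field_simp
        norm_num
      · rw [orbitEmbed_lower ha _ (by omega), orbitEmbed_lower ha _ (by omega),
          show t + 1 + (n + 2 - (i + 1) - j) = t + (n + 2 - i - j) by omega,
          show t + 1 + (n + 2 - i - (j + 1)) = t + (n + 2 - i - j) by omega,
          show n + 1 - (i + 1) = n + 1 - i - 1 by omega, inv_div, inv_div]
        ring
    have e2 : rectBelow (orbitEmbed n κ a t) i j =
        κ * anAboveInv n κ (a (t + (n + 2 - i - j) + 1)) j (n + 1 - i) := by
      rw [rectBelow, anAboveInv]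
      split_ifs with hd hd' hd'
      · rw [mul_inv_cancel₀ hκ.ne']
      · omega
      · omega
      · rw [orbitEmbed_lower ha _ (by omega), orbitEmbed_lower ha _ (by omega),
          show t + (n + 2 - (i - 1) - j) = t + (n + 2 - i - j) + 1 by omega,
          show t + (n + 2 - i - (j - 1)) = t + (n + 2 - i - j) + 1 by omega,
          show n + 1 - (i - 1) = n + 1 - i + 1 by omega]
        ring
    obtain ⟨h1, h2, h3, h4⟩ := hnz (t + (n + 2 - i - j)) j (n + 1 - i) (by omega) (by omega)
      (by omega)
    rw [e1, e2, orbitEmbed_lower ha _ h, orbitEmbed_lower ha _ h,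
      show t + 1 + (n + 2 - i - j) = t + (n + 2 - i - j) + 1 by omega,
      ha.step _ j (n + 1 - i) (by omega) (by omega) (by omega)]
    field_simp
  · have e1 : rectAboveInv (n + 1) (4 * κ ^ 2) (orbitEmbed n κ a (t + 1)) i j =
        (4 * κ)⁻¹ * ((a (t + 1) j j)⁻¹ + (a (t + 1) (j - 1) (j - 1))⁻¹) := by
      rw [rectAboveInv, if_neg (by omega), orbitEmbed_upper ha _ (by omega) (by omega),
        orbitEmbed_upper ha _ (by omega) (by omega),
        show n + 2 - (i + 1) = j - 1 by omega, show n + 2 - i = j by omega, Nat.add_sub_cancel,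
        mul_inv, mul_inv (4 * κ) (a (t + 1) j j)]
      ring
    have e2 : rectBelow (orbitEmbed n κ a t) i j =
        κ * ((a (t + 1) j j)⁻¹ + (a (t + 1) (j - 1) (j - 1))⁻¹) := by
      rw [rectBelow, if_neg (by omega), orbitEmbed_lower ha _ (by omega),
        orbitEmbed_lower ha _ (by omega), show n + 2 - (i - 1) - j = 1 by omega,
        show n + 2 - i - (j - 1) = 1 by omega, show n + 1 - (i - 1) = j by omega,
        show n + 1 - i = j - 1 by omega]
      ring
    rw [e1, e2, orbitEmbed_middle _ hi hj h, orbitEmbed_middle _ hi hj h]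
    generalize (a (t + 1) j j)⁻¹ + (a (t + 1) (j - 1) (j - 1))⁻¹ = s
    rcases eq_or_ne s 0 with rfl | hs
    · simp
    · field_simp
      norm_num
  · have e1 : rectAboveInv (n + 1) (4 * κ ^ 2) (orbitEmbed n κ a (t + 1)) i j =
        (4 * κ)⁻¹ * anAboveInv n κ (a (t + 1)) (n + 2 - i) (j - 1) := by
      rw [rectAboveInv, anAboveInv]
      split_ifs with hd hd' hd'
      · rw [← mul_inv]
        ring
      · omega
      · omega
      · rw [orbitEmbed_upper ha _ (by omega) (by omega),
          orbitEmbed_upper ha _ (by omega) (by omega),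
          show n + 2 - (i + 1) = n + 2 - i - 1 by omega,
          show j + 1 - 1 = j - 1 + 1 by omega, mul_inv,
          mul_inv (4 * κ) (a (t + 1) (n + 2 - i) (j - 1 + 1))]
        ring
    have e2 : rectBelow (orbitEmbed n κ a t) i j =
        4 * κ * anBelow (a t) (n + 2 - i) (j - 1) := by
      rw [rectBelow, if_neg (by omega), anBelow]
      split_ifs with hd
      · rw [orbitEmbed_middle _ (by omega) (by omega) (by omega),
          orbitEmbed_middle _ (by omega) (by omega) (by omega)]
        ring
      · rw [orbitEmbed_upper ha _ (by omega) (by omega),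
          orbitEmbed_upper ha _ (by omega) (by omega),
          show n + 2 - (i - 1) = n + 2 - i + 1 by omega]
        ring
    obtain ⟨h1, h2, h3, h4⟩ := hnz t (n + 2 - i) (j - 1) (by omega) (by omega) (by omega)
    rw [e1, e2, orbitEmbed_upper ha _ (by omega) h,
      orbitEmbed_upper ha _ (by omega) h,
      ha.step _ (n + 2 - i) (j - 1) (by omega) (by omega) (by omega)]
    field_simp

lemma STword_orbitEmbed (hκ : 0 < κ) (ha : IsAnOrbit n κ a) (hn : 1 ≤ n) (t : ℕ) {i : ℕ}
    (hi : 1 ≤ i) (hin : i ≤ 2 * (n + 1)) :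
    STword (n + 1) (n + 1) (4 * κ ^ 2)
      (fun q => rectDown (orbitEmbed n κ a t) q.1.1 q.1.2) i = 2 * κ := by
  have hup : ∀ t (q : RectP (n + 1) (n + 1)), rectDown (orbitEmbed n κ a t) q.1.1 q.1.2 =
      rectUp (n + 1) (4 * κ ^ 2) (orbitEmbed n κ a (t + 1)) q.1.1 q.1.2 := fun t q =>
    (rectUp_orbitEmbed hκ ha hn t q.2.1 q.2.2.1 q.2.2.2.1 q.2.2.2.2).symm
  have hF := isRectLabeling_orbitEmbed hκ ha
  induction hin using Nat.decreasingInduction generalizing t with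
  | self =>
    rw [STword_up_last (by omega) (by positivity) (hF (t + 1)) (hup t)]
    exact orbitEmbed_middle _ le_rfl (by omega) (by omega)
  | of_succ i hlt ih =>
    rw [← STword_down_succ (hF (t + 1)) (hup t) (fun _ => rfl) hi hlt]
    exact ih (t + 1) (by omega)

end

lemma iotaAn_emb (n : ℕ) (κ : ℝ) (π : Phat (AnP n) → ℝ) (q : RectP (n + 1) (n + 1)) :
    iotaAn n κ π (emb q) = iotaVal n κ π q := by
  have h : ∃ q' : RectP (n + 1) (n + 1), emb q = emb q' := ⟨q, rfl⟩
  rw [iotaAn, if_neg (emb_ne_bot q), if_neg (emb_ne_topHat q), dif_pos h,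
    ← emb_injective h.choose_spec]

lemma RvacB_emb {n : ℕ} {κ : ℝ} {π : Phat (AnP n) → ℝ} (h0 : π ⊥ = 1)
    (h1 : π (topHat (AnP n)) = κ) (p : AnP n) :
    RvacB (rkAn n) (n - 1) π (emb p) =
      (filterRow κ (rkAn n) (n - 1))^[rkAn n p + 1] (fun q => π (emb q)) p := by
  rw [← foldr_rvacWordB (rkAn_strictMono n) rkAn_le fun _ _ => rkAn_covBy]
  exact congrFun (applyB_spec (rkAn n) h0 h1 (rvacWordB (n - 1))).2.2 p

lemma rectExt_iotaAn {n : ℕ} {κ : ℝ} {π : Phat (AnP n) → ℝ} (h0 : π ⊥ = 1)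
    (h1 : π (topHat (AnP n)) = κ) :
    rectExt (n + 1) (fun q => iotaAn n κ π (emb q)) = orbitEmbed n κ
      (fun t => anExt n ((filterRow κ (rkAn n) (n - 1))^[t] fun q => π (emb q))) 0 := by
  ext i j
  unfold rectExt orbitEmbed
  split_ifs with h h2 h3
  · have hx : 1 ≤ n + 2 - i ∧ n + 2 - i ≤ j - 1 ∧ j - 1 ≤ n := by omega
    exact (iotaAn_emb n κ π _).trans ((dif_pos h2).trans
      (congrArg (4 * κ * ·) (anExt_apply (fun q => π (emb q)) ⟨(n + 2 - i, j - 1), hx⟩).symm))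
  · exact (iotaAn_emb n κ π _).trans ((dif_neg h2).trans (dif_pos h3))
  · refine (iotaAn_emb n κ π _).trans ((dif_neg h2).trans ((dif_neg h3).trans
      (congrArg (κ / ·) ((RvacB_emb h0 h1 _).trans ?_))))
    have hk : rkAn n ⟨(j, n + 1 - i), by dsimp only; omega⟩ + 1 = 0 + (n + 2 - i - j) := by
      change n + 1 - i - j + 1 = _
      omega
    refine Eq.trans ?_ (dif_pos (by omega)).symm
    exact congrArg (fun k => (filterRow κ (rkAn n) (n - 1))^[k] (fun q => π (emb q)) _) hk
  · rfl

lemma downT_iotaAn {n : ℕ} {κ : ℝ} {π : Phat (AnP n) → ℝ} (h0 : π ⊥ = 1)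
    (h1 : π (topHat (AnP n)) = κ) (q : RectP (n + 1) (n + 1)) :
    downT (iotaAn n κ π) q = rectDown (orbitEmbed n κ
      (fun t => anExt n ((filterRow κ (rkAn n) (n - 1))^[t] fun q => π (emb q))) 0)
        q.1.1 q.1.2 := by
  rw [downT, covSumBelow_emb (if_pos rfl), sumBelow_rect, ← rectExt_iotaAn h0 h1, rectDown,
    rectExt_apply]

end Triangle


/-- Let `n ≥ 1` and `κ > 0`.  If `π ∈ A^B_κ(rect(n,n))` satisfies
`(Row^B_A)^n(π) = Flip(π)`, then the Stanley–Thomas word of `π` is constant: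
`ST(π)_i = √κ` for all `1 ≤ i ≤ 2n`.  In particular, for every `π ∈ F^B_κ(Aⁿ)`, the
Stanley–Thomas word of `∇(ι^B_A π) ∈ A^B_{4κ²}(rect(n+1,n+1))` is constantly `2κ`. -/
theorem stmt13 (n : ℕ) (hn : 1 ≤ n) (κ : ℝ) (hκ : 0 < κ) :
    (∀ π : RectP n n → ℝ, (∀ p, 0 < π p) →
      (RowAB κ (rkRect n n) (2 * n - 2))^[n] π = (fun p => π (flipRect n p)) →
      ∀ i, 1 ≤ i → i ≤ 2 * n → STword n n κ π i = Real.sqrt κ) ∧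
    (∀ π : Phat (AnP n) → ℝ, (∀ x, 0 < π x) → π ⊥ = 1 → π (topHat (AnP n)) = κ →
      ∀ i, 1 ≤ i → i ≤ 2 * (n + 1) →
        STword (n + 1) (n + 1) (4 * κ ^ 2) (downT (iotaAn n κ π)) i = 2 * κ) := by
  refine ⟨fun π hπ hrow i hi hin => STword_eq_sqrt hn hκ hπ hrow hi hin,
    fun π hπ h0 h1 i hi hin => ?_⟩
  rw [funext (downT_iotaAn h0 h1)]
  exact STword_orbitEmbed hκ (isAnOrbit_iterate hκ fun x => hπ (emb x)) hn 0 hi hin
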